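/- Let c be a nonzero codeword of C_m of minimum weight d and let D = Supp(c). Then the sous-escalier N(In_≺(I_D)) contains exactly one monomial of weighted degree strictly greater than m, and this monomial has weighted degree exactly m+1. Moreover, there exists a polynomial f ∈ F[x,y] with LM_≺(f) = x^{μ} y^{λ} such that I_D = ⟨H, f⟩; in other words, D is the complete intersection of the Hermitian curve and the curve defined by f. -/

import Mathlib

open MvPolynomial

noncomputable section

/-- The monomial `x^r y^s` in `F[x,y]`, where `x = X 0`, `y = X 1`. -/
def monoXY (F : Type) [Field F] (r s : ℕ) : MvPolynomial (Fin 2) F := X 0 ^ r * X 1 ^ s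

/-- The Hermitian polynomial `H = x^(q+1) - y^q - y`. -/
def Hpoly (F : Type) [Field F] (q : ℕ) : MvPolynomial (Fin 2) F :=
  X 0 ^ (q + 1) - X 1 ^ q - X 1

/-- Evaluation of a bivariate polynomial at a point of `F × F`. -/
def evalPt {F : Type} [Field F] (p : F × F) (f : MvPolynomial (Fin 2) F) : F :=
  MvPolynomial.eval ![p.1, p.2] f

/-- The vanishing ideal of a set of points `S ⊆ F × F`. -/
def vanIdeal (F : Type) [Field F] (S : Set (F × F)) : Ideal (MvPolynomial (Fin 2) F) where
  carrier := {f | ∀ p ∈ S, evalPt p f = 0}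
  add_mem' := by
    intro a b ha hb p hp
    have h1 := ha p hp
    have h2 := hb p hp
    simp only [evalPt] at h1 h2 ⊢
    simp [map_add, h1, h2]
  zero_mem' := by
    intro p hp
    simp [evalPt]
  smul_mem' := by
    intro c f hf p hp
    have h1 := hf p hp
    simp only [evalPt] at h1 ⊢
    simp [smul_eq_mul, map_mul, h1]

/-- The `DegRevLex` order with `y > x`, on exponent pairs `(a, b) ↔ x^a y^b`. -/
def precOrd : ℕ × ℕ → ℕ × ℕ → Prop := fun a b =>
  a.1 + a.2 < b.1 + b.2 ∨ (a.1 + a.2 = b.1 + b.2 ∧ a.2 < b.2)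

/-- The pair of exponents `(d 0, d 1)` of an exponent finsupp. -/
def expPair (d : Fin 2 →₀ ℕ) : ℕ × ℕ := (d 0, d 1)

/-- `x^r y^s` is the leading monomial of `f` with respect to the monomial order `lt`. -/
def IsLMwith {F : Type} [Field F] (lt : ℕ × ℕ → ℕ × ℕ → Prop)
    (f : MvPolynomial (Fin 2) F) (r s : ℕ) : Prop :=
  MvPolynomial.coeff (Finsupp.single 0 r + Finsupp.single 1 s) f ≠ 0 ∧
    ∀ d ∈ f.support, expPair d = (r, s) ∨ lt (expPair d) (r, s)

/-- The initial ideal of `I` w.r.t. the monomial order `lt`: the ideal generated by the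
leading monomials of the nonzero elements of `I`. -/
def initialIdealWith {F : Type} [Field F] (lt : ℕ × ℕ → ℕ × ℕ → Prop)
    (I : Ideal (MvPolynomial (Fin 2) F)) : Ideal (MvPolynomial (Fin 2) F) :=
  Ideal.span {g | ∃ f ∈ I, f ≠ 0 ∧ ∃ r s, IsLMwith lt f r s ∧ g = monoXY F r s}

/-- The set `E` of `F`-rational affine points of the Hermitian curve. -/
def Eset (F : Type) [Field F] (q : ℕ) : Set (F × F) :=
  {p | p.1 ^ (q + 1) = p.2 ^ q + p.2}

/-- The set `B` of (exponent pairs of) monomials. -/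
def Bset (q : ℕ) : Set (ℕ × ℕ) :=
  {p | (p.1 ≤ q ∧ p.2 ≤ q ^ 2 - q - 1) ∨ (p.1 = 0 ∧ q ^ 2 - q ≤ p.2 ∧ p.2 ≤ q ^ 2 - 1)}

/-- The Hermitian code `C_m` (as a set of vectors), for the enumeration `P` of `E`. -/
def codeSet (F : Type) [Field F] (q m : ℕ) (P : Fin (q ^ 3) → F × F) :
    Set (Fin (q ^ 3) → F) :=
  {c | ∀ r s : ℕ, r * q + s * (q + 1) ≤ m → ∑ i, c i * ((P i).1 ^ r * (P i).2 ^ s) = 0}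

/-- The weight of a codeword: the number of nonzero entries. -/
def wt {F : Type} [Field F] {n : ℕ} (c : Fin n → F) : ℕ := {i | c i ≠ 0}.ncard

/-- The support of a codeword, as a set of points of the curve. -/
def suppPts {F : Type} [Field F] {n : ℕ} (P : Fin n → F × F) (c : Fin n → F) :
    Set (F × F) :=
  P '' {i | c i ≠ 0}

end

/-- The weighted degree of `x^r y^s`. -/
def wdeg (q r s : ℕ) : ℕ := r * q + s * (q + 1)

/-- The span of the monomials `x^r y^s` with `r ≤ q` and weighted degree `< t`, plus the ideal
`I`. -/
noncomputable def lowSpan {F : Type} [Field F] (I : Ideal (MvPolynomial (Fin 2) F)) (q t : ℕ) :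
    Submodule F (MvPolynomial (Fin 2) F) :=
  Submodule.span F {g | ∃ r s, r ≤ q ∧ wdeg q r s < t ∧ g = monoXY F r s} ⊔ I.restrictScalars F

/-- `t` is the weighted degree of a monomial that is not congruent modulo `I` to a polynomial of
smaller weighted degree. -/
def IsJump {F : Type} [Field F] (I : Ideal (MvPolynomial (Fin 2) F)) (q t : ℕ) : Prop :=
  ∃ r s, wdeg q r s = t ∧ monoXY F r s ∉ lowSpan I q t

lemma le_of_wdeg_eq {q r s r' s' : ℕ} (hr : r ≤ q) (h : wdeg q r s = wdeg q r' s') :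
    s' ≤ s := by
  unfold wdeg at h
  by_contra! hs
  obtain ⟨k, rfl⟩ := Nat.exists_eq_add_of_lt hs
  obtain ⟨j, rfl⟩ : ∃ j, r = r' + j :=
    Nat.exists_eq_add_of_le (Nat.le_of_not_lt fun hlt => by nlinarith)
  have h2 : j * q = (k + 1) * (q + 1) := by linarith
  have h3 : (q + 1) ∣ j :=
    Nat.Coprime.dvd_of_dvd_mul_right (by simp) (Dvd.intro_left _ h2.symm)
  rcases Nat.eq_zero_or_pos j with rfl | h0
  · simp at h2
  · have := Nat.le_of_dvd h0 h3
    omega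

lemma wdeg_inj {q r s r' s' : ℕ} (hr : r ≤ q) (hr' : r' ≤ q) (h : wdeg q r s = wdeg q r' s') :
    r = r' ∧ s = s' := by
  obtain rfl := le_antisymm (le_of_wdeg_eq hr' h.symm) (le_of_wdeg_eq hr h)
  refine ⟨?_, rfl⟩
  rcases Nat.eq_zero_or_pos q with h0 | h0
  · omega
  · unfold wdeg at h
    exact Nat.eq_of_mul_eq_mul_right h0 (by linarith)

/-- On exponents with `r, a ≤ q`, smaller weighted degree means smaller in `precOrd`. -/
lemma precOrd_of_wdeg_lt {q r s a b : ℕ} (hr : r ≤ q) (h : wdeg q r s < wdeg q a b) :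
    precOrd (r, s) (a, b) := by
  unfold wdeg at h
  simp only [precOrd]
  rcases lt_trichotomy (r + s) (a + b) with h1 | h1 | h1
  · exact Or.inl h1
  · exact Or.inr ⟨h1, by nlinarith⟩
  · exfalso
    obtain ⟨k, hk⟩ := Nat.exists_eq_add_of_lt h1
    have h2 : (a + b) * q + (k + 1) * q + s < (a + b) * q + b := by
      have : (r + s) * q + s < (a + b) * q + b := by linarith
      rw [hk] at this; linarith
    nlinarith

lemma wdeg_lt_of_precOrd {q r s a b : ℕ} (ha : a ≤ q) (h : precOrd (r, s) (a, b)) :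
    wdeg q r s < wdeg q a b := by
  unfold wdeg
  simp only [precOrd] at h
  rcases h with h | ⟨h, h'⟩
  · have : (r + s + 1) * (q + 1) ≤ (a + b) * (q + 1) := Nat.mul_le_mul_right _ h
    nlinarith
  · have : (r + s) * q = (a + b) * q := by rw [h]
    nlinarith

/-- The semigroup generated by `q` and `q + 1`. -/
lemma exists_wdeg_eq_iff {q : ℕ} (hq : 0 < q) (t : ℕ) :
    (∃ r s, wdeg q r s = t) ↔ t % q ≤ t / q := by
  unfold wdeg
  constructor
  · rintro ⟨r, s, rfl⟩
    have e : r * q + s * (q + 1) = s + (r + s) * q := by ring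
    rw [e, Nat.add_mul_mod_self_right, Nat.add_mul_div_right _ _ hq]
    exact (Nat.mod_le s q).trans ((Nat.le_add_left s r).trans (Nat.le_add_left _ _))
  · intro h
    refine ⟨t / q - t % q, t % q, ?_⟩
    obtain ⟨k, hk⟩ := Nat.exists_eq_add_of_le h
    have := Nat.div_add_mod t q
    rw [hk] at this ⊢
    rw [Nat.add_sub_cancel_left]
    conv_rhs => rw [← this]
    ring

lemma card_gaps_le {q : ℕ} (hq : 0 < q) (n : ℕ) :
    ((Finset.range n).filter fun t => ¬ t % q ≤ t / q).card * 2 ≤ q * (q - 1) := by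
  rw [← Finset.sum_range_id_mul_two]
  refine Nat.mul_le_mul_right _ ?_
  have : ∑ i ∈ Finset.range q, i = ((Finset.range q).sigma fun j => Finset.range j).card := by
    simp
  rw [this]
  refine Finset.card_le_card_of_injOn (fun t => ⟨t % q, t / q⟩) ?_ ?_
  · intro t ht
    simp only [Finset.coe_filter, Set.mem_ofPred_eq] at ht
    simp only [Finset.coe_sigma, Set.mem_sigma_iff, Finset.coe_range, Set.mem_Iio]
    exact ⟨Nat.mod_lt _ hq, by omega⟩
  · intro t _ t' _ h
    simp only [Sigma.mk.injEq, heq_eq_eq] at h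
    rw [← Nat.div_add_mod t q, ← Nat.div_add_mod t' q, h.1, h.2]

/-- The elements of the semigroup `⟨q, q + 1⟩` that divide `t` in the semigroup. -/
def semiDivisors (q t : ℕ) : Finset ℕ :=
  (Finset.range (t + 1)).filter fun s => s % q ≤ s / q ∧ (t - s) % q ≤ (t - s) / q

lemma le_card_semiDivisors {q : ℕ} (hq : 0 < q) (t : ℕ) :
    t + 1 ≤ (semiDivisors q t).card + q * (q - 1) := by
  have h1 := card_gaps_le hq (t + 1)
  set G := (Finset.range (t + 1)).filter fun t => ¬ t % q ≤ t / q with hG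
  have h2 : Finset.range (t + 1) ⊆ semiDivisors q t ∪ (G ∪ G.image fun s => t - s) := by
    intro s hs
    have hst : s ≤ t := by simpa [Nat.lt_succ_iff] using hs
    simp only [semiDivisors, hG, Finset.mem_union, Finset.mem_filter, Finset.mem_image,
      Finset.mem_range]
    by_cases ha : s % q ≤ s / q
    · by_cases hb : (t - s) % q ≤ (t - s) / q
      · exact Or.inl ⟨by omega, ha, hb⟩
      · exact Or.inr (Or.inr ⟨t - s, ⟨by omega, hb⟩, by omega⟩)
    · exact Or.inr (Or.inl ⟨by omega, ha⟩)
  have h3 := Finset.card_le_card h2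
  have h4 := Finset.card_union_le (semiDivisors q t) (G ∪ G.image fun s => t - s)
  have h5 := Finset.card_union_le G (G.image fun s => t - s)
  have h6 : (G.image fun s => t - s).card ≤ G.card := Finset.card_image_le
  rw [Finset.card_range] at h3
  omega

/-- The semigroup `⟨q, q + 1⟩` is symmetric with Frobenius number `q ^ 2 - q - 1`. -/
lemma symm_semigroup {q : ℕ} (hq : 2 ≤ q) {g : ℕ} (hg : ¬ g % q ≤ g / q) :
    g + 1 ≤ q * (q - 1) ∧ (q * (q - 1) - 1 - g) % q ≤ (q * (q - 1) - 1 - g) / q := by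
  have h0 := Nat.div_add_mod g q
  have h1 := Nat.mod_lt g (show 0 < q by omega)
  generalize g / q = k at *
  generalize g % q = j at *
  obtain ⟨i, rfl⟩ : ∃ i, q = i + k + 2 := ⟨q - k - 2, by omega⟩
  obtain ⟨l, hl⟩ : ∃ l, i + k + 2 = j + l + 1 := ⟨i + k + 1 - j, by omega⟩
  have e : (i + k + 2) * (i + k + 2 - 1) - 1 - g = l + i * (i + k + 2) := by
    rw [← h0, show i + k + 2 - 1 = i + k + 1 by omega]
    have : (i + k + 2) * (i + k + 1) = (i + k + 2) * k + j + 1 + (l + i * (i + k + 2)) := by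
      nlinarith
    omega
  constructor
  · rw [← h0, show i + k + 2 - 1 = i + k + 1 by omega]
    nlinarith
  · rw [e, Nat.add_mul_mod_self_right, Nat.add_mul_div_right _ _ (by omega)]
    have hli : l ≤ i := by omega
    exact ((Nat.mod_le l _).trans hli).trans (Nat.le_add_left _ _)

lemma frobenius_gap {q : ℕ} (hq : 2 ≤ q) :
    ¬ (q * (q - 1) - 1) % q ≤ (q * (q - 1) - 1) / q := by
  intro h
  obtain ⟨i, rfl⟩ := Nat.exists_eq_add_of_le hq
  have e : (2 + i) * (2 + i - 1) - 1 = (1 + i) + i * (2 + i) := by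
    rw [show 2 + i - 1 = 1 + i by omega]
    have : (2 + i) * (1 + i) = (1 + i) + i * (2 + i) + 1 := by ring
    omega
  rw [e, Nat.add_mul_mod_self_right, Nat.add_mul_div_right _ _ (by omega),
    Nat.mod_eq_of_lt (by omega), Nat.div_eq_of_lt (by omega)] at h
  omega

section LowSpan

variable {F : Type} [Field F] {q : ℕ} {I : Ideal (MvPolynomial (Fin 2) F)}

lemma monoXY_eq_monomial (r s : ℕ) :
    monoXY F r s = monomial (Finsupp.single 0 r + Finsupp.single 1 s) 1 := by
  simp [monoXY, X_pow_eq_monomial, monomial_mul]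

lemma finsupp_fin_two_eq (e : Fin 2 →₀ ℕ) :
    Finsupp.single 0 (e 0) + Finsupp.single 1 (e 1) = e := by
  ext i
  fin_cases i <;> simp

lemma monomial_eq_smul_monoXY (e : Fin 2 →₀ ℕ) (a : F) :
    monomial e a = a • monoXY F (e 0) (e 1) := by
  rw [monoXY_eq_monomial, finsupp_fin_two_eq, smul_monomial, smul_eq_mul, mul_one]

lemma monoXY_mul (r s r' s' : ℕ) :
    monoXY F r s * monoXY F r' s' = monoXY F (r + r') (s + s') := by
  simp only [monoXY]; ring

lemma wdeg_add (q r s r' s' : ℕ) : wdeg q (r + r') (s + s') = wdeg q r s + wdeg q r' s' := by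
  simp only [wdeg]; ring

lemma lowSpan_mono {t t' : ℕ} (h : t ≤ t') : lowSpan I q t ≤ lowSpan I q t' := by
  refine sup_le_sup_right (Submodule.span_mono ?_) _
  rintro g ⟨r, s, hr, hw, rfl⟩
  exact ⟨r, s, hr, by omega, rfl⟩

lemma mem_lowSpan_of_mem {t : ℕ} {p : MvPolynomial (Fin 2) F} (h : p ∈ I) : p ∈ lowSpan I q t :=
  Submodule.mem_sup_right (by simpa using h)

lemma normal_mem_lowSpan {t r s : ℕ} (hr : r ≤ q) (h : wdeg q r s < t) :
    monoXY F r s ∈ lowSpan I q t :=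
  Submodule.mem_sup_left (Submodule.subset_span ⟨r, s, hr, h, rfl⟩)

/-- Reduction of a monomial modulo the Hermitian polynomial. -/
lemma exists_normal (hq : 2 ≤ q) (hH : Hpoly F q ∈ I) (r s : ℕ) :
    ∃ r' s', r' ≤ q ∧ wdeg q r' s' = wdeg q r s ∧
      monoXY F r s - monoXY F r' s' ∈ lowSpan I q (wdeg q r s) := by
  induction r using Nat.strong_induction_on generalizing s with
  | _ r ih =>
    rcases le_or_gt r q with hr | hr
    · exact ⟨r, s, hr, rfl, by simp⟩
    · obtain ⟨k, rfl⟩ := Nat.exists_eq_add_of_lt hr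
      obtain ⟨r', s', hr', hw', h'⟩ := ih k (by omega) (s + q)
      obtain ⟨r₂, s₂, hr₂, hw₂, h₂⟩ := ih k (by omega) (s + 1)
      have e1 : wdeg q k (s + q) = wdeg q (q + k + 1) s := by simp only [wdeg]; ring
      have e2 : wdeg q k (s + 1) < wdeg q (q + k + 1) s := by
        simp only [wdeg]
        nlinarith [Nat.mul_le_mul_right (q + 1) hq]
      refine ⟨r', s', hr', by omega, ?_⟩
      rw [e1] at h'
      have h3 : monoXY F k (s + 1) ∈ lowSpan I q (wdeg q (q + k + 1) s) := by
        have := add_mem (lowSpan_mono e2.le h₂)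
          (normal_mem_lowSpan (F := F) (I := I) hr₂ (hw₂ ▸ e2))
        simpa using this
      have h4 : monoXY F k s * Hpoly F q ∈ lowSpan I q (wdeg q (q + k + 1) s) :=
        mem_lowSpan_of_mem (I.mul_mem_left _ hH)
      have := add_mem (add_mem h' h3) h4
      convert this using 1
      simp only [monoXY, Hpoly]
      ring

lemma monoXY_mem_lowSpan (hq : 2 ≤ q) (hH : Hpoly F q ∈ I) {t r s : ℕ} (h : wdeg q r s < t) :
    monoXY F r s ∈ lowSpan I q t := by
  obtain ⟨r', s', hr', hw, hm⟩ := exists_normal hq hH r s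
  rw [← sub_add_cancel (monoXY F r s) (monoXY F r' s')]
  exact add_mem (lowSpan_mono h.le hm) (normal_mem_lowSpan hr' (hw ▸ h))

lemma monoXY_sub_mem_lowSpan (hq : 2 ≤ q) (hH : Hpoly F q ∈ I) {r s r' s' : ℕ}
    (h : wdeg q r s = wdeg q r' s') :
    monoXY F r s - monoXY F r' s' ∈ lowSpan I q (wdeg q r s) := by
  obtain ⟨a, b, ha, hw, hm⟩ := exists_normal hq hH r s
  obtain ⟨a', b', ha', hw', hm'⟩ := exists_normal hq hH r' s'
  obtain ⟨rfl, rfl⟩ := wdeg_inj ha ha' (hw.trans (h.trans hw'.symm))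
  rw [← h] at hm'
  simpa using sub_mem hm hm'

lemma monoXY_mul_mem_lowSpan (hq : 2 ≤ q) (hH : Hpoly F q ∈ I) {t r s : ℕ}
    {p : MvPolynomial (Fin 2) F} (hp : p ∈ lowSpan I q t) :
    monoXY F r s * p ∈ lowSpan I q (wdeg q r s + t) := by
  obtain ⟨p₁, h₁, p₂, h₂, rfl⟩ := Submodule.mem_sup.1 hp
  rw [mul_add]
  refine add_mem ?_ (mem_lowSpan_of_mem (I.mul_mem_left _ (by simpa using h₂)))
  induction h₁ using Submodule.span_induction with
  | mem g hg =>
    obtain ⟨a, b, -, hw, rfl⟩ := hg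
    rw [monoXY_mul]
    exact monoXY_mem_lowSpan hq hH (by rw [wdeg_add]; omega)
  | zero => simp
  | add g g' _ _ hg hg' =>
    rw [mul_add]
    exact add_mem (hg (add_mem (Submodule.mem_sup_left ‹_›) (Submodule.mem_sup_right h₂)))
      (hg' (add_mem (Submodule.mem_sup_left ‹_›) (Submodule.mem_sup_right h₂)))
  | smul a g _ hg =>
    rw [mul_smul_comm]
    exact Submodule.smul_mem _ _
      (hg (add_mem (Submodule.mem_sup_left ‹_›) (Submodule.mem_sup_right h₂)))

lemma monoXY_notMem_of_isJump (hq : 2 ≤ q) (hH : Hpoly F q ∈ I) {r s : ℕ}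
    (h : IsJump I q (wdeg q r s)) : monoXY F r s ∉ lowSpan I q (wdeg q r s) := by
  obtain ⟨r', s', hw, hn⟩ := h
  intro hm
  apply hn
  have := monoXY_sub_mem_lowSpan (F := F) hq hH hw
  rw [hw] at this
  simpa using add_mem this hm

lemma isJump_of_add (hq : 2 ≤ q) (hH : Hpoly F q ∈ I) {r s r' s' : ℕ}
    (h : IsJump I q (wdeg q r s + wdeg q r' s')) : IsJump I q (wdeg q r s) := by
  refine ⟨r, s, rfl, fun hm => ?_⟩
  rw [← wdeg_add] at h
  refine monoXY_notMem_of_isJump hq hH h ?_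
  have := monoXY_mul_mem_lowSpan (r := r') (s := s') hq hH hm
  rwa [monoXY_mul, add_comm r', add_comm s', ← wdeg_add, add_comm r', add_comm s'] at this

lemma exists_mem_lowSpan (hq : 2 ≤ q) (hH : Hpoly F q ∈ I) (p : MvPolynomial (Fin 2) F) :
    ∃ t, p ∈ lowSpan I q t := by
  induction p using MvPolynomial.induction_on' with
  | monomial e a =>
    refine ⟨wdeg q (e 0) (e 1) + 1, ?_⟩
    rw [monomial_eq_smul_monoXY]
    exact Submodule.smul_mem _ _ (monoXY_mem_lowSpan hq hH (by omega))
  | add p p' h h' =>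
    obtain ⟨t, ht⟩ := h
    obtain ⟨t', ht'⟩ := h'
    exact ⟨max t t', add_mem (lowSpan_mono (le_max_left _ _) ht)
      (lowSpan_mono (le_max_right _ _) ht')⟩

/-- Monomials whose weighted degrees are distinct jumps are linearly independent modulo `I`. -/
lemma eq_zero_of_sum_mem {v : ℕ → MvPolynomial (Fin 2) F} (T : Finset ℕ)
    (hv : ∀ t ∈ T, v t ∈ lowSpan I q (t + 1)) (hv' : ∀ t ∈ T, v t ∉ lowSpan I q t)
    (a : ℕ → F) (h : ∑ t ∈ T, a t • v t ∈ I) : ∀ t ∈ T, a t = 0 := by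
  induction T using Finset.induction_on_max with
  | empty => simp
  | insert u T hu ih =>
    have hnot : u ∉ T := fun h => lt_irrefl _ (hu u h)
    rw [Finset.sum_insert hnot] at h
    have hlow : ∑ t ∈ T, a t • v t ∈ lowSpan I q u :=
      Submodule.sum_mem _ fun t ht => Submodule.smul_mem _ _
        (lowSpan_mono (hu t ht) (hv t (Finset.mem_insert_of_mem ht)))
    have hau : a u = 0 := by
      by_contra hne
      apply hv' u (Finset.mem_insert_self _ _)
      have := sub_mem (mem_lowSpan_of_mem (q := q) (t := u) h) hlow
      rw [add_sub_cancel_right] at this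
      exact (Submodule.smul_mem_iff _ hne).1 this
    rw [hau, zero_smul, zero_add] at h
    intro t ht
    rcases Finset.mem_insert.1 ht with rfl | ht
    · exact hau
    · exact ih (fun t ht => hv t (Finset.mem_insert_of_mem ht))
        (fun t ht => hv' t (Finset.mem_insert_of_mem ht)) h t ht

/-- A normal monomial that is congruent modulo `I` to a polynomial of smaller weighted degree is
the leading monomial of an element of `I`. -/
lemma exists_isLMwith {r s : ℕ} (h : monoXY F r s ∈ lowSpan I q (wdeg q r s)) :
    ∃ f ∈ I, IsLMwith precOrd f r s ∧
      monoXY F r s - f ∈ Submodule.span F {g | ∃ a b, a ≤ q ∧ wdeg q a b < wdeg q r s ∧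
        g = monoXY F a b} := by
  classical
  obtain ⟨p₁, h₁, p₂, h₂, he⟩ := Submodule.mem_sup.1 h
  have key : ∀ e, coeff e p₁ ≠ 0 → e 0 ≤ q ∧ wdeg q (e 0) (e 1) < wdeg q r s := by
    clear he
    induction h₁ using Submodule.span_induction with
    | mem g hg =>
      obtain ⟨a, b, ha, hw, rfl⟩ := hg
      intro e he
      rw [monoXY_eq_monomial, coeff_monomial] at he
      have : Finsupp.single 0 a + Finsupp.single 1 b = e := by
        by_contra hne; simp [hne] at he
      subst this
      simpa using ⟨ha, hw⟩
    | zero => simp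
    | add g g' _ _ hg hg' =>
      intro e he
      rw [coeff_add] at he
      by_cases h0 : coeff e g = 0
      · exact hg' e (by simpa [h0] using he)
      · exact hg e h0
    | smul a g _ hg =>
      intro e he
      rw [coeff_smul] at he
      exact hg e (by aesop)
  refine ⟨p₂, by simpa using h₂, ⟨?_, ?_⟩, ?_⟩
  · have hp : p₂ = monoXY F r s - p₁ := by rw [← he]; ring
    have h0 : coeff (Finsupp.single 0 r + Finsupp.single 1 s) p₁ = 0 := by
      by_contra hne
      have := (key _ hne).2
      simp at this
    rw [hp, coeff_sub, h0, monoXY_eq_monomial]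
    simp
  · have hp : p₂ = monoXY F r s - p₁ := by rw [← he]; ring
    intro e he
    rw [mem_support_iff, hp, coeff_sub, monoXY_eq_monomial, coeff_monomial] at he
    by_cases h1 : Finsupp.single 0 r + Finsupp.single 1 s = e
    · left
      subst h1
      simp [expPair]
    · right
      have := key e (by simpa [h1] using he)
      exact precOrd_of_wdeg_lt this.1 this.2
  · rw [← he]
    simpa using h₁

lemma monoXY_mem_initialIdealWith {f : MvPolynomial (Fin 2) F} {r s a b : ℕ} (hf : f ∈ I)
    (hLM : IsLMwith precOrd f r s) (ha : r ≤ a) (hb : s ≤ b) :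
    monoXY F a b ∈ initialIdealWith precOrd I := by
  obtain ⟨a, rfl⟩ := Nat.exists_eq_add_of_le ha
  obtain ⟨b, rfl⟩ := Nat.exists_eq_add_of_le hb
  rw [← monoXY_mul]
  refine Ideal.mul_mem_right _ _ (Ideal.subset_span ⟨f, hf, ?_, r, s, hLM, rfl⟩)
  rintro rfl
  exact hLM.1 (by simp)

lemma isLMwith_Hpoly (hq : 2 ≤ q) : IsLMwith precOrd (Hpoly F q) (q + 1) 0 := by
  classical
  have e : Hpoly F q = monoXY F (q + 1) 0 - monoXY F 0 q - monoXY F 0 1 := by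
    simp [Hpoly, monoXY]
  have hc : ∀ e : Fin 2 →₀ ℕ, ∀ r s, coeff e (monoXY F r s) =
      if expPair e = (r, s) then 1 else 0 := by
    intro e r s
    rw [monoXY_eq_monomial, coeff_monomial]
    congr 1
    rw [← finsupp_fin_two_eq e]
    apply propext
    simp only [expPair, Prod.mk.injEq]
    constructor
    · intro h
      exact ⟨by simpa using (DFunLike.congr_fun h 0).symm,
        by simpa using (DFunLike.congr_fun h 1).symm⟩
    · rintro ⟨h0, h1⟩
      rw [finsupp_fin_two_eq] at h0 h1
      rw [h0, h1]
  constructor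
  · rw [e, coeff_sub, coeff_sub, hc, hc, hc]
    simp [expPair]
  · intro d hd
    rw [mem_support_iff, e, coeff_sub, coeff_sub, hc, hc, hc] at hd
    by_cases h1 : expPair d = (q + 1, 0)
    · exact Or.inl h1
    · right
      by_cases h2 : expPair d = (0, q)
      · rw [h2]; left; simp
      · by_cases h3 : expPair d = (0, 1)
        · rw [h3]; left; simp; omega
        · simp [h1, h2, h3] at hd

lemma le_of_notMem_initialIdealWith (hq : 2 ≤ q) (hH : Hpoly F q ∈ I) {a b : ℕ}
    (h : monoXY F a b ∉ initialIdealWith precOrd I) : a ≤ q := by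
  by_contra hlt
  exact h (monoXY_mem_initialIdealWith hH (isLMwith_Hpoly hq) (by omega) (Nat.zero_le _))

lemma isJump_of_notMem_initialIdealWith {a b : ℕ}
    (h : monoXY F a b ∉ initialIdealWith precOrd I) : IsJump I q (wdeg q a b) := by
  refine ⟨a, b, rfl, fun hm => h ?_⟩
  obtain ⟨f, hf, hLM, -⟩ := exists_isLMwith hm
  exact monoXY_mem_initialIdealWith hf hLM le_rfl le_rfl

lemma notMem_initialIdealWith_of_isJump (hq : 2 ≤ q) (hH : Hpoly F q ∈ I) {a b : ℕ} (ha : a ≤ q)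
    (h : IsJump I q (wdeg q a b)) : monoXY F a b ∉ initialIdealWith precOrd I := by
  intro hm
  have hset : {g | ∃ f ∈ I, f ≠ 0 ∧ ∃ r s, IsLMwith precOrd f r s ∧ g = monoXY F r s} =
      (fun e => monomial e (1 : F)) ''
        {e | ∃ f ∈ I, IsLMwith precOrd f (e 0) (e 1)} := by
    ext g
    constructor
    · rintro ⟨f, hf, -, r, s, hLM, rfl⟩
      exact ⟨Finsupp.single 0 r + Finsupp.single 1 s, ⟨f, hf, by simpa using hLM⟩,
        (monoXY_eq_monomial r s).symm⟩
    · rintro ⟨e, ⟨f, hf, hLM⟩, rfl⟩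
      refine ⟨f, hf, ?_, e 0, e 1, hLM, ?_⟩
      · rintro rfl
        exact hLM.1 (by simp)
      · simp [monomial_eq_smul_monoXY]
  rw [initialIdealWith, hset, mem_ideal_span_monomial_image] at hm
  obtain ⟨e, ⟨f, hf, hLM⟩, hle⟩ := hm (Finsupp.single 0 a + Finsupp.single 1 b) (by
    rw [monoXY_eq_monomial, mem_support_iff]; simp)
  have h0 : e 0 ≤ a := by simpa using hle 0
  have h1 : e 1 ≤ b := by simpa using hle 1
  refine monoXY_notMem_of_isJump hq hH h ?_
  obtain ⟨k, hk⟩ := Nat.exists_eq_add_of_le h0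
  obtain ⟨l, hl⟩ := Nat.exists_eq_add_of_le h1
  have hred : monoXY F (e 0) (e 1) ∈ lowSpan I q (wdeg q (e 0) (e 1)) := by
    have hne := hLM.1
    rw [finsupp_fin_two_eq] at hne
    have hsum : coeff e f • monoXY F (e 0) (e 1) =
        f - ∑ i ∈ f.support.erase e, monomial i (coeff i f) := by
      have hmem : e ∈ f.support := mem_support_iff.2 hne
      rw [← monomial_eq_smul_monoXY, eq_sub_iff_add_eq,
        Finset.add_sum_erase _ (fun i => monomial i (coeff i f)) hmem]
      exact support_sum_monomial_coeff f
    rw [← Submodule.smul_mem_iff _ hne, hsum]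
    refine sub_mem (mem_lowSpan_of_mem hf) (Submodule.sum_mem _ fun i hi => ?_)
    rw [monomial_eq_smul_monoXY]
    refine Submodule.smul_mem _ _ (monoXY_mem_lowSpan hq hH ?_)
    obtain ⟨hie, hi⟩ := Finset.mem_erase.1 hi
    rcases hLM.2 i hi with h | h
    · exfalso
      apply hie
      rw [← finsupp_fin_two_eq i, ← finsupp_fin_two_eq e]
      simp only [expPair, Prod.mk.injEq] at h
      rw [h.1, h.2]
    · exact wdeg_lt_of_precOrd (h0.trans ha) h
  have := monoXY_mul_mem_lowSpan (r := k) (s := l) hq hH hred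
  rwa [monoXY_mul, ← wdeg_add, add_comm k, add_comm l, ← hk, ← hl] at this

end LowSpan

lemma mod_le_div_of_isJump {F : Type} [Field F] {q t : ℕ} {I : Ideal (MvPolynomial (Fin 2) F)}
    (hq : 0 < q) (h : IsJump I q t) : t % q ≤ t / q := by
  obtain ⟨r, s, hw, -⟩ := h
  exact (exists_wdeg_eq_iff hq t).1 ⟨r, s, hw⟩

lemma isJump_of_mem_semiDivisors {F : Type} [Field F] {q t s : ℕ}
    {I : Ideal (MvPolynomial (Fin 2) F)} (hq : 2 ≤ q) (hH : Hpoly F q ∈ I) (h : IsJump I q t)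
    (hs : s ∈ semiDivisors q t) : IsJump I q s := by
  simp only [semiDivisors, Finset.mem_filter, Finset.mem_range] at hs
  obtain ⟨hst, h1, h2⟩ := hs
  obtain ⟨a, b, hab⟩ := (exists_wdeg_eq_iff (by omega) s).2 h1
  obtain ⟨a', b', hab'⟩ := (exists_wdeg_eq_iff (by omega) (t - s)).2 h2
  rw [← hab]
  refine isJump_of_add (r' := a') (s' := b') hq hH ?_
  rwa [hab, hab', Nat.add_sub_cancel' (by omega)]

/-- The vanishing ideal of `S` has at most `|S|` jumps. -/
lemma card_le_ncard_of_isJump {F : Type} [Field F] {q : ℕ} {S : Set (F × F)} (hS : S.Finite)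
    (hq : 2 ≤ q) (hH : Hpoly F q ∈ vanIdeal F S) (T : Finset ℕ)
    (hT : ∀ t ∈ T, IsJump (vanIdeal F S) q t) : T.card ≤ S.ncard := by
  classical
  choose! a b hw hn using hT
  let ev : MvPolynomial (Fin 2) F →ₗ[F] (S → F) :=
    LinearMap.pi fun p => (MvPolynomial.aeval ![p.1.1, p.1.2]).toLinearMap
  have hev : ∀ f, ev f = 0 → f ∈ vanIdeal F S := by
    intro f hf p hp
    have := congrFun hf ⟨p, hp⟩
    simpa [ev, evalPt, aeval_eq_eval] using this
  have hli : LinearIndependent F fun t : T => ev (monoXY F (a t) (b t)) := by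
    rw [Fintype.linearIndependent_iff]
    intro g hg t
    let g' : ℕ → F := fun t => if h : t ∈ T then g ⟨t, h⟩ else 0
    have hsum : ∑ t ∈ T, g' t • monoXY F (a t) (b t) ∈ vanIdeal F S := by
      apply hev
      rw [map_sum, ← hg, ← Finset.sum_coe_sort T]
      refine Finset.sum_congr rfl fun t _ => ?_
      simp [g']
    have := eq_zero_of_sum_mem (q := q) T
      (fun t ht => monoXY_mem_lowSpan hq hH (by rw [hw t ht]; omega)) hn g' hsum t t.2
    simpa [g'] using this
  have := hS.fintype
  have h := hli.fintype_card_le_finrank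
  rw [Module.finrank_fintype_fun_eq_card, Fintype.card_coe] at h
  rwa [Set.ncard_eq_toFinset_card', Set.toFinset_card]

/-- If all jumps of the ideal `J` lie in a finite set of jumps of the larger ideal `I`, then
`I = J`. -/
lemma ideal_eq_of_isJump {F : Type} [Field F] {q : ℕ} {I J : Ideal (MvPolynomial (Fin 2) F)}
    (hq : 2 ≤ q) (hJI : J ≤ I) (hH : Hpoly F q ∈ J) (T : Finset ℕ)
    (hT : ∀ t ∈ T, IsJump I q t) (hJ : ∀ t, IsJump J q t → t ∈ T) : I = J := by
  refine le_antisymm (fun g hg => ?_) hJI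
  choose! a b hw hn using hT
  let U : Submodule F (MvPolynomial (Fin 2) F) :=
    Submodule.span F ((fun t => monoXY F (a t) (b t)) '' T) ⊔ J.restrictScalars F
  have hU : ∀ t, lowSpan J q t ≤ U := by
    intro t
    induction t with
    | zero =>
      refine sup_le (Submodule.span_le.2 ?_) le_sup_right
      rintro g ⟨r, s, -, h, -⟩
      exact absurd h (Nat.not_lt_zero _)
    | succ t ih =>
      refine sup_le (Submodule.span_le.2 ?_) le_sup_right
      rintro g ⟨r, s, hr, h, rfl⟩
      rcases (Nat.lt_succ_iff.1 h).lt_or_eq with h | h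
      · exact ih (normal_mem_lowSpan hr h)
      · by_cases ht : t ∈ T
        · have h1 := monoXY_sub_mem_lowSpan (F := F) hq hH (h.trans (hw t ht).symm)
          rw [h] at h1
          rw [← sub_add_cancel (monoXY F r s) (monoXY F (a t) (b t))]
          exact add_mem (ih h1) (Submodule.mem_sup_left (Submodule.subset_span ⟨t, ht, rfl⟩))
        · apply ih
          by_contra hnot
          exact ht (hJ t ⟨r, s, h, hnot⟩)
  obtain ⟨t, ht⟩ := exists_mem_lowSpan hq hH g
  obtain ⟨u, hu, j, hj, rfl⟩ := Submodule.mem_sup.1 (hU t ht)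
  have hj : j ∈ J := by simpa using hj
  obtain ⟨k, rfl⟩ := (Submodule.mem_span_image_finset_iff_exists_fun' F).1 hu
  have h0 := eq_zero_of_sum_mem (q := q) T
    (fun t ht => monoXY_mem_lowSpan hq (hJI hH) (by rw [hw t ht]; omega)) hn k
    ((Ideal.add_mem_iff_left _ (hJI hj)).1 hg)
  rw [Finset.sum_eq_zero fun t ht => by rw [h0 t ht, zero_smul], zero_add]
  exact hj

lemma evalPt_monoXY {F : Type} [Field F] (p : F × F) (r s : ℕ) :
    evalPt p (monoXY F r s) = p.1 ^ r * p.2 ^ s := by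
  simp [evalPt, monoXY]

/-- A nonzero codeword of `C_m` forces a jump above `m`. -/
lemma exists_isJump_gt {F : Type} [Field F] [Finite F] {q m n : ℕ} {P : Fin n → F × F}
    (hP : Function.Injective P) {c : Fin n → F} (hc0 : c ≠ 0)
    (hc : ∀ r s, wdeg q r s ≤ m → ∑ i, c i * ((P i).1 ^ r * (P i).2 ^ s) = 0) :
    ∃ t, m < t ∧ IsJump (vanIdeal F (suppPts P c)) q t := by
  classical
  have := Fintype.ofFinite F
  let φ : MvPolynomial (Fin 2) F →ₗ[F] F :=
    ∑ i, c i • (MvPolynomial.aeval ![(P i).1, (P i).2]).toLinearMap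
  have hφ : ∀ f, φ f = ∑ i, c i * evalPt (P i) f := by
    intro f
    simp [φ, evalPt, aeval_eq_eval]
  have hφI : ∀ f ∈ vanIdeal F (suppPts P c), φ f = 0 := by
    intro f hf
    rw [hφ]
    refine Finset.sum_eq_zero fun i _ => ?_
    by_cases hi : c i = 0
    · simp [hi]
    · rw [hf (P i) ⟨i, hi, rfl⟩, mul_zero]
  have hex : ∃ t, ∃ r s, wdeg q r s = t ∧ φ (monoXY F r s) ≠ 0 := by
    by_contra! hno
    have hzero : ∀ f, φ f = 0 := by
      intro f
      induction f using MvPolynomial.induction_on' with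
      | monomial e a => rw [monomial_eq_smul_monoXY, map_smul, hno _ _ _ rfl, smul_zero]
      | add p p' h h' => rw [map_add, h, h', add_zero]
    apply hc0
    funext i
    have h := hzero (MvPolynomial.indicator ![(P i).1, (P i).2])
    rw [hφ, Finset.sum_eq_single i] at h
    · simpa [evalPt, eval_indicator_apply_eq_one] using h
    · intro j _ hji
      rw [evalPt, eval_indicator_apply_eq_zero, mul_zero]
      intro heq
      apply hji
      apply hP
      exact Prod.ext (by simpa using congrFun heq 0) (by simpa using congrFun heq 1)
    · simp
  obtain ⟨r, s, hw, hne⟩ := Nat.find_spec hex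
  refine ⟨Nat.find hex, ?_, r, s, hw, fun hmem => hne ?_⟩
  · by_contra hle
    apply hne
    rw [hφ]
    simp only [evalPt_monoXY]
    exact hc r s (by omega)
  · have hle : lowSpan (vanIdeal F (suppPts P c)) q (Nat.find hex) ≤ LinearMap.ker φ := by
      refine sup_le (Submodule.span_le.2 ?_) fun f hf => hφI f (by simpa using hf)
      rintro g ⟨a, b, -, hab, rfl⟩
      by_contra hg
      exact Nat.find_min hex hab ⟨a, b, rfl, hg⟩
    exact hle hmem

theorem stmt_18 (q : ℕ) (hq2 : 2 ≤ q) (hq : IsPrimePow q)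
    (F : Type) [Field F] [Fintype F] (hF : Fintype.card F = q ^ 2)
    (P : Fin (q ^ 3) → F × F) (hPinj : Function.Injective P)
    (hPrange : Set.range P = Eset F q)
    (m μ lam d : ℕ) (hm1 : 2 * q ^ 2 - 2 * q - 2 ≤ m) (hm2 : m ≤ q ^ 3 + q * (q - 1) - 2)
    (hB : ∃ p ∈ Bset q, p.1 * q + p.2 * (q + 1) = m + 1)
    (hμ : μ ≤ q) (hmeq : m = μ * q + (lam + q - 2) * (q + 1))
    (hd : d = μ * q + lam * (q + 1))
    (c : Fin (q ^ 3) → F) (hc : c ∈ codeSet F q m P) (hc0 : c ≠ 0) (hwt : wt c = d) :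
    (∃! p : ℕ × ℕ,
        monoXY F p.1 p.2 ∉ initialIdealWith precOrd (vanIdeal F (suppPts P c)) ∧
          m < p.1 * q + p.2 * (q + 1)) ∧
    (∀ a b : ℕ,
        monoXY F a b ∉ initialIdealWith precOrd (vanIdeal F (suppPts P c)) →
          m < a * q + b * (q + 1) → a * q + b * (q + 1) = m + 1) ∧
    (∃ f : MvPolynomial (Fin 2) F, IsLMwith precOrd f μ lam ∧
        vanIdeal F (suppPts P c) = Ideal.span {Hpoly F q, f}) := by
  have hq0 : 0 < q := by omega
  set S := suppPts P c with hSdef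
  have hSE : S ⊆ Eset F q := by
    rintro p ⟨i, -, rfl⟩
    exact hPrange ▸ Set.mem_range_self i
  have hH : Hpoly F q ∈ vanIdeal F S := by
    intro p hp
    have h : p.1 ^ (q + 1) = p.2 ^ q + p.2 := hSE hp
    simp [evalPt, Hpoly, h]
  have hcard : S.ncard = d := by
    rw [← hwt, wt, hSdef, suppPts, Set.ncard_image_of_injective _ hPinj]
  have hgap : 2 ≤ q * (q - 1) := by
    obtain ⟨k, rfl⟩ := Nat.exists_eq_add_of_le hq2
    rw [show 2 + k - 1 = k + 1 by omega]
    nlinarith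
  have hmd : m + 1 = d + (q * (q - 1) - 1) := by
    obtain ⟨k, rfl⟩ := Nat.exists_eq_add_of_le hq2
    rw [show lam + (2 + k) - 2 = lam + k by omega] at hmeq
    rw [show 2 + k - 1 = k + 1 by omega] at hgap ⊢
    have h1 : (2 + k) * (k + 1) = k * (2 + k + 1) + 2 := by ring
    have h2 : (lam + k) * (2 + k + 1) = lam * (2 + k + 1) + k * (2 + k + 1) := by ring
    omega
  have hcardle := card_le_ncard_of_isJump S.toFinite hq2 hH
  obtain ⟨t, hmt, ht⟩ := exists_isJump_gt (q := q) (m := m) hPinj hc0 hc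
  rw [← hSdef] at ht
  have hdiv : ∀ s ∈ semiDivisors q t, IsJump (vanIdeal F S) q s :=
    fun s hs => isJump_of_mem_semiDivisors hq2 hH ht hs
  have hle := le_card_semiDivisors hq0 t
  have htm : t = m + 1 := by
    have := hcardle _ hdiv
    omega
  subst htm
  have hjump : ∀ s, IsJump (vanIdeal F S) q s ↔ s ∈ semiDivisors q (m + 1) := by
    refine fun s => ⟨fun hs => ?_, hdiv s⟩
    by_contra hnot
    have h := hcardle (insert s (semiDivisors q (m + 1))) (by
      intro u hu
      rcases Finset.mem_insert.1 hu with rfl | hu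
      · exact hs
      · exact hdiv u hu)
    rw [Finset.card_insert_of_notMem hnot] at h
    omega
  have hmax : ∀ a b : ℕ, monoXY F a b ∉ initialIdealWith precOrd (vanIdeal F S) →
      m < a * q + b * (q + 1) → a * q + b * (q + 1) = m + 1 := by
    intro a b hab hlt
    have h := (hjump _).1 (isJump_of_notMem_initialIdealWith hab)
    simp only [semiDivisors, Finset.mem_filter, Finset.mem_range, wdeg] at h
    omega
  refine ⟨?_, hmax, ?_⟩
  · obtain ⟨r, s, hw, -⟩ := id ht
    obtain ⟨a, b, ha, hab, -⟩ := exists_normal hq2 hH r s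
    rw [hw] at hab
    refine ⟨(a, b), ⟨notMem_initialIdealWith_of_isJump hq2 hH ha (hab ▸ ht), ?_⟩, ?_⟩
    · simp only [wdeg] at hab
      simp only
      omega
    · rintro ⟨a', b'⟩ ⟨hn, hlt⟩
      obtain ⟨rfl, rfl⟩ := wdeg_inj (le_of_notMem_initialIdealWith hq2 hH hn) ha
        ((hmax a' b' hn hlt).trans hab.symm)
      rfl
  · have hdw : wdeg q μ lam = d := hd.symm
    have hnd : monoXY F μ lam ∈ lowSpan (vanIdeal F S) q (wdeg q μ lam) := by
      by_contra hnot
      have h := (hjump _).1 ⟨μ, lam, rfl, hnot⟩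
      simp only [semiDivisors, Finset.mem_filter, Finset.mem_range] at h
      rw [hdw, hmd, Nat.add_sub_cancel_left] at h
      exact frobenius_gap hq2 h.2.2
    obtain ⟨f, hf, hLM, hlow⟩ := exists_isLMwith hnd
    refine ⟨f, hLM, ?_⟩
    have hHJ : Hpoly F q ∈ Ideal.span {Hpoly F q, f} := Ideal.subset_span (by simp)
    have hfJ : f ∈ Ideal.span {Hpoly F q, f} := Ideal.subset_span (by simp)
    refine ideal_eq_of_isJump hq2 (Ideal.span_le.2 ?_) hHJ _ hdiv fun s hs => ?_
    · rintro g (rfl | rfl)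
      · exact hH
      · exact hf
    · have hs1 := mod_le_div_of_isJump hq0 hs
      have hs2 : ¬ (d ≤ s ∧ (s - d) % q ≤ (s - d) / q) := by
        rintro ⟨hds, hsd⟩
        obtain ⟨a, b, hab⟩ := (exists_wdeg_eq_iff hq0 _).2 hsd
        have hs' : IsJump (Ideal.span {Hpoly F q, f}) q (wdeg q μ lam) := by
          refine isJump_of_add (r' := a) (s' := b) hq2 hHJ ?_
          rwa [hdw, hab, Nat.add_sub_cancel' hds]
        refine monoXY_notMem_of_isJump hq2 hHJ hs' ?_
        rw [← sub_add_cancel (monoXY F μ lam) f]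
        exact add_mem (Submodule.mem_sup_left hlow) (mem_lowSpan_of_mem hfJ)
      simp only [semiDivisors, Finset.mem_filter, Finset.mem_range]
      rcases le_or_gt d s with hds | hds
      · obtain ⟨h1, h2⟩ := symm_semigroup hq2 fun h => hs2 ⟨hds, h⟩
        refine ⟨by omega, hs1, ?_⟩
        rwa [show m + 1 - s = q * (q - 1) - 1 - (s - d) by omega]
      · refine ⟨by omega, hs1, ?_⟩
        by_contra hgap'
        have := (symm_semigroup hq2 hgap').1
        omega
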